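/- Let n ≥ 2, let φ₁ be a propagation complete encoding of AMO_n of minimum size, and let φ₂ be a propagation complete encoding of EXO_n of minimum size. Then S(n) ≤ |φ₁| ≤ S(n) + 1 and S(n) ≤ |φ₂| ≤ S(n) + 1. -/

import Mathlib

/-- A literal is a variable together with a polarity (`true` = positive). -/
abbrev Lit (V : Type) := V × Bool

/-- The negation of a literal. -/
def negLit {V : Type} (l : Lit V) : Lit V := (l.1, !l.2)

/-- A clause is a finite set of literals. -/
abbrev Clause (V : Type) := Finset (Lit V)

/-- A CNF formula is a finite set of clauses. -/
abbrev CNF (V : Type) := Finset (Clause V)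

/-- A clause proper contains no complementary pair of literals. -/
def IsClause {V : Type} [DecidableEq V] (C : Clause V) : Prop := ∀ l ∈ C, negLit l ∉ C

instance {V : Type} [DecidableEq V] (C : Clause V) : Decidable (IsClause C) := by
  unfold IsClause; infer_instance

/-- A CNF formula proper consists of proper clauses. -/
def IsCNF {V : Type} [DecidableEq V] (φ : CNF V) : Prop := ∀ C ∈ φ, IsClause C

/-- Satisfaction of a literal by an assignment. -/
def LitSat {V : Type} (α : V → Bool) (l : Lit V) : Prop := α l.1 = l.2

/-- Satisfaction of a clause by an assignment. -/
def ClauseSat {V : Type} (α : V → Bool) (C : Clause V) : Prop := ∃ l ∈ C, LitSat α l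

/-- Satisfaction of a CNF formula by an assignment. -/
def CnfSat {V : Type} (α : V → Bool) (φ : CNF V) : Prop := ∀ C ∈ φ, ClauseSat α C

/-- `UnitDerives φ C` : the clause `C` can be derived from `φ` by a series of unit
resolutions (each step resolves a derived unit clause with another derived clause). -/
inductive UnitDerives {V : Type} [DecidableEq V] (φ : CNF V) : Clause V → Prop
  | base {C : Clause V} (h : C ∈ φ) : UnitDerives φ C
  | step {l : Lit V} {C : Clause V} (h1 : UnitDerives φ {l})
      (h2 : UnitDerives φ C) (h3 : negLit l ∈ C) :
      UnitDerives φ (C.erase (negLit l))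

/-- The formula `φ ∧ l` (adding a unit clause). -/
def addUnit {V : Type} [DecidableEq V] (φ : CNF V) (l : Lit V) : CNF V :=
  insert {l} φ

/-- The formula `φ ∧ g₁ ∧ … ∧ g_p` (adding finitely many unit clauses). -/
def addUnits {V : Type} [DecidableEq V] (φ : CNF V) (L : Finset (Lit V)) : CNF V :=
  φ ∪ L.image (fun l => ({l} : Clause V))

/-- Variables: `n` input variables and `ℓ` auxiliary variables. -/
abbrev Var (n ℓ : ℕ) : Type := Sum (Fin n) (Fin ℓ)

/-- The literal on the `i`-th input variable with polarity `b`. -/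
def inLit {n ℓ : ℕ} (i : Fin n) (b : Bool) : Lit (Var n ℓ) := (Sum.inl i, b)

/-- A p-encoding: (P1) `φ ∧ x_i` is satisfiable for each input variable `x_i`, and
(P2) `φ ∧ x_i ⊢₁ ¬x_j` for all `i ≠ j`. -/
def IsPEncoding {n ℓ : ℕ} (φ : CNF (Var n ℓ)) : Prop :=
  IsCNF φ ∧
  (∀ i : Fin n, ∃ α : Var n ℓ → Bool, CnfSat α φ ∧ α (Sum.inl i) = true) ∧
  (∀ i j : Fin n, i ≠ j →
    UnitDerives (addUnit φ (inLit i true)) {inLit j false})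

/-- A p-encoding relative to a set `I` of input indices. -/
def IsPEncodingOn {n ℓ : ℕ} (φ : CNF (Var n ℓ)) (I : Finset (Fin n)) : Prop :=
  IsCNF φ ∧
  (∀ i ∈ I, ∃ α : Var n ℓ → Bool, CnfSat α φ ∧ α (Sum.inl i) = true) ∧
  (∀ i ∈ I, ∀ j ∈ I, i ≠ j →
    UnitDerives (addUnit φ (inLit i true)) {inLit j false})

/-- 2-CNF: every clause has at most two literals. -/
def Is2CNF {V : Type} (φ : CNF V) : Prop := ∀ C ∈ φ, C.card ≤ 2

/-- The set of possible sizes of p-encodings with `n` input variables. -/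
def pencSizes (n : ℕ) : Set ℕ :=
  {k | ∃ ℓ : ℕ, ∃ φ : CNF (Var n ℓ), IsPEncoding φ ∧ φ.card = k}

/-- `S n` : the minimum size of a p-encoding with `n` input variables. -/
noncomputable def S (n : ℕ) : ℕ := sInf (pencSizes n)

/-- The set of possible sizes of 2-CNF p-encodings with `n` input variables. -/
def penc2Sizes (n : ℕ) : Set ℕ :=
  {k | ∃ ℓ : ℕ, ∃ φ : CNF (Var n ℓ), IsPEncoding φ ∧ Is2CNF φ ∧ φ.card = k}

/-- `S₂ n` : the minimum size of a 2-CNF p-encoding with `n` input variables. -/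
noncomputable def S2 (n : ℕ) : ℕ := sInf (penc2Sizes n)

/-- `φ(x,y)` is an encoding of the boolean function `f(x)`. -/
def Encodes {n ℓ : ℕ} (φ : CNF (Var n ℓ)) (f : (Fin n → Bool) → Prop) : Prop :=
  IsCNF φ ∧
  ∀ α : Fin n → Bool, f α ↔ ∃ β : Fin ℓ → Bool, CnfSat (Sum.elim α β) φ

/-- Injection of literals on input variables into literals of the encoding. -/
def inLits {n ℓ : ℕ} (G : Finset (Lit (Fin n))) : Finset (Lit (Var n ℓ)) :=
  G.image (fun g => ((Sum.inl g.1 : Var n ℓ), g.2))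

/-- Propagation complete encoding of `f`: an encoding such that whenever
`f ∧ g₁ ∧ … ∧ g_p ⊨ h` for literals on input variables (`p ≥ 1`), unit propagation
from `φ ∧ g₁ ∧ … ∧ g_p` derives `h` or derives the empty clause. -/
def IsPCEncoding {n ℓ : ℕ} (φ : CNF (Var n ℓ)) (f : (Fin n → Bool) → Prop) : Prop :=
  Encodes φ f ∧
  ∀ G : Finset (Lit (Fin n)), G.Nonempty → ∀ h : Lit (Fin n),
    (∀ α : Fin n → Bool, f α → (∀ g ∈ G, α g.1 = g.2) → α h.1 = h.2) →
    (UnitDerives (addUnits φ (inLits G)) {((Sum.inl h.1 : Var n ℓ), h.2)} ∨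
     UnitDerives (addUnits φ (inLits G)) (∅ : Clause (Var n ℓ)))

/-- The "at most one" function. -/
def AMO (n : ℕ) (α : Fin n → Bool) : Prop :=
  (Finset.univ.filter fun i => α i = true).card ≤ 1

/-- The "exactly one" function. -/
def EXO (n : ℕ) (α : Fin n → Bool) : Prop :=
  (Finset.univ.filter fun i => α i = true).card = 1

/-- `Qset φ i` : the set of clauses of `φ` containing the literal `¬x_i`. -/
def Qset {n ℓ : ℕ} (φ : CNF (Var n ℓ)) (i : Fin n) : CNF (Var n ℓ) :=
  φ.filter (fun C => inLit i false ∈ C)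

/-- Regular form: for each `i`, `|Q_i| = 2`, clauses of `Q_i` contain no input variables
other than `x_i`, and all clauses of `Q_i` are binary. -/
def RegularForm {n ℓ : ℕ} (φ : CNF (Var n ℓ)) : Prop :=
  ∀ i : Fin n,
    (Qset φ i).card = 2 ∧
    (∀ C ∈ Qset φ i, ∀ j : Fin n, ∀ b : Bool, ((Sum.inl j : Var n ℓ), b) ∈ C → j = i) ∧
    (∀ C ∈ Qset φ i, C.card = 2)

/-- `C` is an implicate of `φ`. -/
def Implicate {V : Type} (φ : CNF V) (C : Clause V) : Prop :=
  ∀ α : V → Bool, CnfSat α φ → ClauseSat α C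

/-- `C` is a prime implicate of `φ`. -/
def PrimeImplicate {V : Type} (φ : CNF V) (C : Clause V) : Prop :=
  Implicate φ C ∧ ∀ C' : Clause V, C' ⊂ C → ¬ Implicate φ C'

/-- `φ` is prime: every clause of `φ` is a prime implicate of `φ`. -/
def IsPrime {V : Type} (φ : CNF V) : Prop := ∀ C ∈ φ, PrimeImplicate φ C

/-- The set of clauses of `φ` in which the auxiliary variable `y` occurs
(as a positive or negative literal). -/
def occursIn {n ℓ : ℕ} (φ : CNF (Var n ℓ)) (y : Fin ℓ) : CNF (Var n ℓ) :=
  φ.filter (fun C => ((Sum.inr y : Var n ℓ), true) ∈ C ∨ ((Sum.inr y : Var n ℓ), false) ∈ C)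

/-- The substitution `g₁ ← g₂` on a literal: `g₁ ↦ g₂`, `¬g₁ ↦ ¬g₂`,
all other literals unchanged. -/
def substLit {V : Type} [DecidableEq V] (g₁ g₂ : Lit V) (l : Lit V) : Lit V :=
  if l.1 = g₁.1 then (if l.2 = g₁.2 then g₂ else negLit g₂) else l

/-- The substitution `g₁ ← g₂` applied to a clause. -/
def substClause {V : Type} [DecidableEq V] (g₁ g₂ : Lit V) (C : Clause V) : Clause V :=
  C.image (substLit g₁ g₂)

/-- The formula `φ[g₁ ← g₂]`: apply the substitution to every clause and remove the
clauses that became tautological (i.e. contain a complementary pair of literals). -/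
def substCNF {V : Type} [DecidableEq V] (g₁ g₂ : Lit V) (φ : CNF V) : CNF V :=
  (φ.image (substClause g₁ g₂)).filter (fun C => IsClause C)

/-- `restrict φ ρ` : the formula `φ(ρ)` obtained from `φ` by the partial assignment
given by the set of literals `ρ` (clauses satisfied by `ρ` are removed, and falsified
literals are removed from the remaining clauses). -/
def restrict {V : Type} [DecidableEq V] (φ : CNF V) (ρ : Finset (Lit V)) : CNF V :=
  (φ.filter (fun C => ∀ l ∈ ρ, l ∉ C)).image (fun C => C.filter (fun l => negLit l ∉ ρ))

section UnitResolution

variable {V : Type}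

@[simp]
lemma negLit_negLit (l : Lit V) : negLit (negLit l) = l := by
  simp [negLit]

variable [DecidableEq V]

lemma UnitDerives.mono {φ ψ : CNF V} (h : φ ⊆ ψ) {C : Clause V} (hC : UnitDerives φ C) :
    UnitDerives ψ C := by
  induction hC with
  | base hC => exact .base (h hC)
  | step _ _ h3 ih1 ih2 => exact .step ih1 ih2 h3

/-- Unit resolution is sound. -/
lemma UnitDerives.sound {φ : CNF V} {α : V → Bool} (hα : CnfSat α φ) {C : Clause V}
    (hC : UnitDerives φ C) : ClauseSat α C := by
  induction hC with
  | base hC => exact hα _ hC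
  | @step l C _ _ _ ih1 ih2 =>
    obtain ⟨k, hk, hk'⟩ := ih2
    obtain ⟨m, hm, hm'⟩ := ih1
    rw [Finset.mem_singleton] at hm
    subst hm
    refine ⟨k, Finset.mem_erase.2 ⟨?_, hk⟩, hk'⟩
    rintro rfl
    simp [LitSat, negLit] at hk' hm'
    simp [hm'] at hk'

/-- Derived clauses may be used as premises. -/
lemma UnitDerives.trans {φ ψ : CNF V} (h : ∀ C ∈ ψ, UnitDerives φ C) {C : Clause V}
    (hC : UnitDerives ψ C) : UnitDerives φ C := by
  induction hC with
  | base hC => exact h _ hC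
  | step _ _ h3 ih1 ih2 => exact .step ih1 ih2 h3

lemma UnitDerives.resolve {φ : CNF V} {l m : Lit V} (hlm : m ≠ negLit l)
    (hl : UnitDerives φ {l}) (hC : UnitDerives φ {negLit l, m}) : UnitDerives φ {m} := by
  have h := UnitDerives.step hl hC (by simp)
  rwa [Finset.erase_insert (by simpa using hlm.symm)] at h

lemma UnitDerives.empty {φ : CNF V} {l : Lit V}
    (hl : UnitDerives φ {l}) (hl' : UnitDerives φ {negLit l}) : UnitDerives φ ∅ := by
  simpa using UnitDerives.step hl hl' (by simp)

/-- All literals whose negations are derived may be removed from a derived clause. -/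
lemma UnitDerives.sdiff {φ : CNF V} {C : Clause V} (hC : UnitDerives φ C) (L : Finset (Lit V))
    (hL : ∀ l ∈ L, UnitDerives φ {negLit l}) : UnitDerives φ (C \ L) := by
  induction L using Finset.induction_on with
  | empty => simpa using hC
  | insert l L _ ih =>
    have ih := ih fun k hk => hL k (Finset.mem_insert_of_mem hk)
    rw [Finset.sdiff_insert]
    by_cases hl : l ∈ C \ L
    · simpa using UnitDerives.step (hL l (Finset.mem_insert_self _ _)) ih (by simpa using hl)
    · rwa [Finset.erase_eq_of_notMem hl]

end UnitResolution

section Renaming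

variable {V W : Type}

/-- Rename the variable of a literal. -/
def renameLit (f : V → W) (l : Lit V) : Lit W := (f l.1, l.2)

lemma renameLit_injective {f : V → W} (hf : f.Injective) : (renameLit f).Injective := by
  rintro ⟨v, b⟩ ⟨w, c⟩ h
  simp only [renameLit, Prod.mk.injEq] at h
  rw [hf h.1, h.2]

lemma negLit_renameLit (f : V → W) (l : Lit V) :
    negLit (renameLit f l) = renameLit f (negLit l) := rfl

variable [DecidableEq W]

/-- Rename the variables of a formula. -/
def renameCNF (f : V → W) (φ : CNF V) : CNF W := φ.image (Finset.image (renameLit f))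

lemma CnfSat.rename {f : V → W} {φ : CNF V} {α : W → Bool} (h : CnfSat (α ∘ f) φ) :
    CnfSat α (renameCNF f φ) := by
  intro C hC
  obtain ⟨D, hD, rfl⟩ := Finset.mem_image.1 hC
  obtain ⟨k, hk, hk'⟩ := h D hD
  exact ⟨_, Finset.mem_image_of_mem _ hk, hk'⟩

variable [DecidableEq V]

lemma IsCNF.rename {f : V → W} (hf : f.Injective) {φ : CNF V} (hφ : IsCNF φ) :
    IsCNF (renameCNF f φ) := by
  intro C hC l hl hl'
  obtain ⟨D, hD, rfl⟩ := Finset.mem_image.1 hC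
  obtain ⟨k, hk, rfl⟩ := Finset.mem_image.1 hl
  rw [negLit_renameLit, (renameLit_injective hf).mem_finset_image] at hl'
  exact hφ D hD k hk hl'

lemma UnitDerives.rename {f : V → W} (hf : f.Injective) {φ : CNF V} {C : Clause V}
    (hC : UnitDerives φ C) : UnitDerives (renameCNF f φ) (C.image (renameLit f)) := by
  induction hC with
  | base hC => exact .base (Finset.mem_image_of_mem _ hC)
  | @step l C _ _ h3 ih1 ih2 =>
    rw [Finset.image_erase (renameLit_injective hf), ← negLit_renameLit]
    rw [Finset.image_singleton] at ih1
    exact .step ih1 ih2 (Finset.mem_image_of_mem _ h3)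

lemma UnitDerives.rename_addUnit {f : V → W} (hf : f.Injective) {φ : CNF V} {l m : Lit V}
    (h : UnitDerives (addUnit φ l) {m}) :
    UnitDerives (addUnit (renameCNF f φ) (renameLit f l)) {renameLit f m} := by
  simpa [renameCNF, addUnit] using h.rename hf

end Renaming

section InputFunctions

variable {n : ℕ}

/-- The assignment whose only true variable is `i`. -/
def unitAssign (i : Fin n) (j : Fin n) : Bool := decide (j = i)

lemma AMO_iff {α : Fin n → Bool} :
    AMO n α ↔ ∀ i j, α i = true → α j = true → i = j := by
  simp only [AMO, Finset.card_le_one, Finset.mem_filter, Finset.mem_univ, true_and]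
  grind

lemma EXO_iff {α : Fin n → Bool} : EXO n α ↔ AMO n α ∧ ∃ i, α i = true := by
  have h : (∃ i, α i = true) ↔ 0 < (Finset.univ.filter fun i => α i = true).card := by
    simp [Finset.card_pos, Finset.Nonempty]
  rw [h, EXO, AMO]
  omega

lemma EXO_unitAssign (i : Fin n) : EXO n (unitAssign i) := by
  rw [EXO_iff, AMO_iff]
  exact ⟨by simp [unitAssign], i, by simp [unitAssign]⟩

lemma AMO_unitAssign (i : Fin n) : AMO n (unitAssign i) := (EXO_iff.1 (EXO_unitAssign i)).1

lemma AMO.eq_unitAssign {α : Fin n → Bool} (h : AMO n α) {i : Fin n} (hi : α i = true) :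
    α = unitAssign i := by
  funext j
  by_cases hj : j = i
  · simp [unitAssign, hj, hi]
  · simp only [unitAssign, hj, decide_false]
    by_contra hj'
    exact hj (AMO_iff.1 h j i (by simpa using hj') hi)

end InputFunctions

section PEncodings

variable {n ℓ : ℕ}

lemma UnitDerives.addUnits_of_mem {φ : CNF (Var n ℓ)} {G : Finset (Lit (Fin n))}
    {g : Lit (Fin n)} (hg : g ∈ G) :
    UnitDerives (addUnits φ (inLits G)) {((Sum.inl g.1 : Var n ℓ), g.2)} :=
  .base (Finset.mem_union_right _
    (Finset.mem_image_of_mem _ (Finset.mem_image_of_mem _ hg)))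

/-- A propagation complete encoding of a function that implies `AMO` and holds at every
unit assignment is a p-encoding. -/
lemma IsPCEncoding.isPEncoding {φ : CNF (Var n ℓ)} {f : (Fin n → Bool) → Prop}
    (h : IsPCEncoding φ f) (hAMO : ∀ α, f α → AMO n α) (hunit : ∀ i, f (unitAssign i)) :
    IsPEncoding φ := by
  have hsat : ∀ i : Fin n, ∃ α : Var n ℓ → Bool, CnfSat α φ ∧ α (Sum.inl i) = true := by
    intro i
    obtain ⟨β, hβ⟩ := (h.1.2 _).1 (hunit i)
    exact ⟨_, hβ, by simp [unitAssign]⟩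
  refine ⟨h.1.1, hsat, fun i j hij => ?_⟩
  have hadd : addUnits φ (inLits {(i, true)}) = addUnit φ (inLit i true) := by
    simp [addUnits, addUnit, inLits, inLit]
  have hpc := h.2 {(i, true)} (by simp) (j, false) fun α hα hi => by
    have hi : α i = true := by simpa using hi
    by_contra hj
    exact hij (AMO_iff.1 (hAMO α hα) i j hi (by simpa using hj))
  rw [hadd] at hpc
  rcases hpc with hpc | hpc
  · exact hpc
  · obtain ⟨α, hα, hi⟩ := hsat i
    have hα' : CnfSat α (addUnit φ (inLit i true)) := by
      intro C hC
      rcases Finset.mem_insert.1 hC with rfl | hC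
      · exact ⟨_, Finset.mem_singleton_self _, hi⟩
      · exact hα C hC
    obtain ⟨_, hmem, _⟩ := hpc.sound hα'
    simp at hmem

lemma IsPEncoding.amo_of_sat {φ : CNF (Var n ℓ)} (h : IsPEncoding φ) {α : Var n ℓ → Bool}
    (hα : CnfSat α φ) : AMO n (α ∘ Sum.inl) := by
  rw [AMO_iff]
  intro i j hi hj
  by_contra hij
  have hα' : CnfSat α (addUnit φ (inLit i true)) := by
    intro C hC
    rcases Finset.mem_insert.1 hC with rfl | hC
    · exact ⟨_, Finset.mem_singleton_self _, hi⟩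
    · exact hα C hC
  obtain ⟨l, hl, hl'⟩ := (h.2.2 i j hij).sound hα'
  rw [Finset.mem_singleton] at hl
  subst hl
  simp_all [LitSat, inLit]

lemma IsPEncoding.exists_sat_unitAssign {φ : CNF (Var n ℓ)} (h : IsPEncoding φ) (i : Fin n) :
    ∃ β : Fin ℓ → Bool, CnfSat (Sum.elim (unitAssign i) β) φ := by
  obtain ⟨α, hα, hi⟩ := h.2.1 i
  refine ⟨α ∘ Sum.inr, ?_⟩
  rw [← (h.amo_of_sat hα).eq_unitAssign hi, Sum.elim_comp_inl_inr]
  exact hα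

/-- Unit propagation in a p-encoding is complete once a positive input literal is assumed. -/
lemma IsPEncoding.propagates_of_pos {φ : CNF (Var n ℓ)} (h : IsPEncoding φ)
    {G : Finset (Lit (Fin n))} {i : Fin n} (hi : (i, true) ∈ G) (g : Lit (Fin n))
    (hg : (∀ k ∈ G, unitAssign i k.1 = k.2) → unitAssign i g.1 = g.2) :
    UnitDerives (addUnits φ (inLits G)) {((Sum.inl g.1 : Var n ℓ), g.2)} ∨
      UnitDerives (addUnits φ (inLits G)) (∅ : Clause (Var n ℓ)) := by
  have key : ∀ k : Lit (Fin n), unitAssign i k.1 = k.2 →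
      UnitDerives (addUnits φ (inLits G)) {((Sum.inl k.1 : Var n ℓ), k.2)} := by
    rintro ⟨j, b⟩ hk
    by_cases hj : j = i
    · subst hj
      obtain rfl : true = b := by simpa [unitAssign] using hk
      exact .addUnits_of_mem hi
    · obtain rfl : false = b := by simpa [unitAssign, hj] using hk
      refine (h.2.2 i j (Ne.symm hj)).trans fun C hC => ?_
      rcases Finset.mem_insert.1 hC with rfl | hC
      · exact .addUnits_of_mem hi
      · exact .base (Finset.mem_union_left _ hC)
  by_cases hgi : unitAssign i g.1 = g.2
  · exact .inl (key g hgi)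
  · obtain ⟨k, hk, hk'⟩ : ∃ k ∈ G, unitAssign i k.1 ≠ k.2 := by
      by_contra! hcon
      exact hgi (hg hcon)
    refine .inr (UnitDerives.empty (.addUnits_of_mem hk) (key (k.1, !k.2) ?_))
    simpa [Bool.eq_not] using hk'

/-- A p-encoding consistent with the zero input is a propagation complete encoding of `AMO`. -/
lemma IsPEncoding.isPCEncoding_AMO {φ : CNF (Var n ℓ)} (h : IsPEncoding φ)
    (h0 : ∃ β : Fin ℓ → Bool, CnfSat (Sum.elim (fun _ => false) β) φ) :
    IsPCEncoding φ (AMO n) := by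
  refine ⟨⟨h.1, fun α => ⟨fun hα => ?_, ?_⟩⟩, fun G _ g hg => ?_⟩
  · by_cases hex : ∃ i, α i = true
    · obtain ⟨i, hi⟩ := hex
      rw [hα.eq_unitAssign hi]
      exact h.exists_sat_unitAssign i
    · obtain rfl : α = fun _ => false := by
        funext i
        simpa using fun hi => hex ⟨i, hi⟩
      exact h0
  · rintro ⟨β, hβ⟩
    simpa using h.amo_of_sat hβ
  by_cases hpos : ∃ i, (i, true) ∈ G
  · obtain ⟨i, hi⟩ := hpos
    exact h.propagates_of_pos hi g (hg _ (AMO_unitAssign i))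
  · have hneg : ∀ k ∈ G, k.2 = false := by
      rintro ⟨i, b⟩ hk
      cases b
      · rfl
      · exact (hpos ⟨i, hk⟩).elim
    obtain ⟨j, b⟩ := g
    obtain rfl : false = b :=
      hg (fun _ => false) (by simp [AMO]) fun k hk => (hneg k hk).symm
    by_cases hjG : (j, false) ∈ G
    · exact .inl (.addUnits_of_mem hjG)
    · have := hg _ (AMO_unitAssign j) fun k hk => by
        rw [hneg k hk]
        have : k.1 ≠ j := by
          rintro rfl
          exact hjG (by rw [← hneg k hk]; exact hk)
        simp [unitAssign, this]
      simp [unitAssign] at this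

/-- The clause `x₁ ∨ ⋯ ∨ xₙ`. -/
def atLeastOne (n ℓ : ℕ) : Clause (Var n ℓ) := Finset.univ.image fun i => inLit i true

lemma clauseSat_atLeastOne {α : Var n ℓ → Bool} :
    ClauseSat α (atLeastOne n ℓ) ↔ ∃ i, α (Sum.inl i) = true := by
  simp [ClauseSat, atLeastOne, LitSat, inLit]

/-- Adding the clause `x₁ ∨ ⋯ ∨ xₙ` to a p-encoding gives a propagation complete encoding
of `EXO`. -/
lemma IsPEncoding.isPCEncoding_EXO {φ : CNF (Var n ℓ)} (h : IsPEncoding φ) :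
    IsPCEncoding (insert (atLeastOne n ℓ) φ) (EXO n) := by
  have hsat : ∀ i, ∃ β : Fin ℓ → Bool,
      CnfSat (Sum.elim (unitAssign i) β) (insert (atLeastOne n ℓ) φ) := by
    intro i
    obtain ⟨β, hβ⟩ := h.exists_sat_unitAssign i
    refine ⟨β, fun C hC => ?_⟩
    rcases Finset.mem_insert.1 hC with rfl | hC
    · exact clauseSat_atLeastOne.2 ⟨i, by simp [unitAssign]⟩
    · exact hβ C hC
  have hP : IsPEncoding (insert (atLeastOne n ℓ) φ) := by
    refine ⟨fun C hC => ?_, fun i => ?_, fun i j hij => (h.2.2 i j hij).mono ?_⟩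
    · rcases Finset.mem_insert.1 hC with rfl | hC
      · simp [IsClause, atLeastOne, negLit, inLit]
      · exact h.1 C hC
    · obtain ⟨β, hβ⟩ := hsat i
      exact ⟨_, hβ, by simp [unitAssign]⟩
    · exact Finset.insert_subset_insert _ (Finset.subset_insert _ _)
  refine ⟨⟨hP.1, fun α => ⟨fun hα => ?_, ?_⟩⟩, fun G _ g hg => ?_⟩
  · obtain ⟨hamo, i, hi⟩ := EXO_iff.1 hα
    rw [hamo.eq_unitAssign hi]
    exact hsat i
  · rintro ⟨β, hβ⟩
    refine EXO_iff.2 ⟨by simpa using hP.amo_of_sat hβ, ?_⟩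
    simpa using clauseSat_atLeastOne.1 (hβ _ (Finset.mem_insert_self _ _))
  by_cases hpos : ∃ i, (i, true) ∈ G
  · obtain ⟨i, hi⟩ := hpos
    exact hP.propagates_of_pos hi g (hg _ (EXO_unitAssign i))
  have hneg : ∀ k ∈ G, k.2 = false := by
    rintro ⟨i, b⟩ hk
    cases b
    · rfl
    · exact (hpos ⟨i, hk⟩).elim
  have hfree : ∀ j, (j, false) ∉ G → unitAssign j g.1 = g.2 := by
    refine fun j hj => hg _ (EXO_unitAssign j) fun k hk => ?_
    rw [hneg k hk]
    have : k.1 ≠ j := by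
      rintro rfl
      exact hj (by rw [← hneg k hk]; exact hk)
    simp [unitAssign, this]
  have hrest := UnitDerives.sdiff (φ := addUnits (insert (atLeastOne n ℓ) φ) (inLits G))
    (.base (Finset.mem_union_left _ (Finset.mem_insert_self _ _)))
    ((Finset.univ.filter fun j => (j, false) ∈ G).image fun j => inLit j true) (by
      intro l hl
      obtain ⟨j, hj, rfl⟩ := Finset.mem_image.1 hl
      exact .addUnits_of_mem (Finset.mem_filter.1 hj).2)
  have hmem : ∀ l, l ∈ atLeastOne n ℓ \
      ((Finset.univ.filter fun j => (j, false) ∈ G).image fun j => inLit j true) ↔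
      ∃ j, (j, false) ∉ G ∧ inLit j true = l := by
    intro l
    simp only [atLeastOne, Finset.mem_sdiff, Finset.mem_image, Finset.mem_univ, true_and,
      Finset.mem_filter, inLit]
    grind
  obtain ⟨k, b⟩ := g
  by_cases hall : ∀ j, (j, false) ∈ G
  · right
    convert hrest
    symm
    rw [Finset.eq_empty_iff_forall_notMem]
    intro l hl
    obtain ⟨j, hj, _⟩ := (hmem l).1 hl
    exact hj (hall j)
  · left
    push Not at hall
    obtain ⟨j, hj⟩ := hall
    cases b
    · by_cases hk : (k, false) ∈ G
      · exact .addUnits_of_mem hk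
      · simpa [unitAssign] using hfree k hk
    · have hjk : ∀ i, (i, false) ∉ G → i = k := fun i hi => by
        simpa [unitAssign, eq_comm] using hfree i hi
      convert hrest
      ext l
      rw [hmem, Finset.mem_singleton]
      constructor
      · rintro rfl
        exact ⟨k, hjk j hj ▸ hj, rfl⟩
      · rintro ⟨i, hi, rfl⟩
        rw [hjk i hi]
        rfl

/-- The embedding of variables that turns the input variable `i` into the new last
auxiliary variable. -/
def hideVar (i : Fin n) : Var n ℓ → Var n (ℓ + 1)
  | .inl j => if j = i then .inr (Fin.last ℓ) else .inl j
  | .inr k => .inr k.castSucc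

lemma hideVar_injective (i : Fin n) : (hideVar (ℓ := ℓ) i).Injective := by
  rintro (j | k) (j' | k') h
  · simp only [hideVar] at h
    grind
  · simp only [hideVar] at h
    split_ifs at h
    exact absurd (Sum.inr.inj h).symm (Fin.castSucc_lt_last k').ne
  · simp only [hideVar] at h
    split_ifs at h
    exact absurd (Sum.inr.inj h) (Fin.castSucc_lt_last k).ne
  · simpa [hideVar] using h

/-- The formula in which the input variable `i` is replaced by a new auxiliary variable `z`
subject to `¬xᵢ ∨ z`. -/
def relaxInput (i : Fin n) (φ : CNF (Var n ℓ)) : CNF (Var n (ℓ + 1)) :=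
  insert {inLit i false, (Sum.inr (Fin.last ℓ), true)} (renameCNF (hideVar i) φ)

lemma CnfSat.relaxInput {i : Fin n} {φ : CNF (Var n ℓ)} {α : Var n ℓ → Bool}
    (hα : CnfSat α φ) {ξ : Fin n → Bool} (hξ : ∀ j ≠ i, ξ j = α (Sum.inl j))
    (hi : ξ i = true → α (Sum.inl i) = true) :
    CnfSat (Sum.elim ξ (Fin.snoc (α ∘ Sum.inr) (α (Sum.inl i)))) (relaxInput i φ) := by
  intro C hC
  rcases Finset.mem_insert.1 hC with rfl | hC
  · cases hξi : ξ i
    · exact ⟨inLit i false, by simp, by simp [LitSat, inLit, hξi]⟩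
    · exact ⟨(Sum.inr (Fin.last ℓ), true), by simp, by simp [LitSat, hi hξi]⟩
  · refine CnfSat.rename (f := hideVar i) ?_ C hC
    convert hα
    funext v
    rcases v with j | k
    · by_cases hj : j = i
      · simp [hideVar, hj]
      · simp [hideVar, hj, hξ j hj]
    · simp [hideVar]

lemma IsPEncoding.relaxInput {φ : CNF (Var n ℓ)} (h : IsPEncoding φ) (i : Fin n) :
    IsPEncoding (relaxInput i φ) := by
  refine ⟨fun C hC => ?_, fun j => ?_, fun j k hjk => ?_⟩
  · rcases Finset.mem_insert.1 hC with rfl | hC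
    · simp [IsClause, negLit, inLit]
    · exact h.1.rename (hideVar_injective i) C hC
  · obtain ⟨α, hα, hj⟩ := h.2.1 j
    exact ⟨_, hα.relaxInput (ξ := α ∘ Sum.inl) (fun _ _ => rfl) id, hj⟩
  have himp : UnitDerives (addUnit (_root_.relaxInput i φ) (inLit j true))
      {inLit i false, (Sum.inr (Fin.last ℓ), true)} :=
    .base (Finset.mem_insert_of_mem (Finset.mem_insert_self _ _))
  have hj : UnitDerives (addUnit (_root_.relaxInput i φ) (inLit j true))
      {renameLit (hideVar i) (inLit j true)} := by
    by_cases hji : j = i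
    · subst hji
      have hunit : UnitDerives (addUnit (_root_.relaxInput j φ) (inLit j true))
          {inLit j true} := .base (Finset.mem_insert_self _ _)
      simpa [renameLit, inLit, hideVar] using
        hunit.resolve (m := (Sum.inr (Fin.last ℓ), true)) (by simp [negLit, inLit]) himp
    · refine .base (Finset.mem_insert.2 (.inl ?_))
      simp [renameLit, inLit, hideVar, hji]
  have hk := ((h.2.2 j k hjk).rename_addUnit (hideVar_injective i)).trans
    (φ := addUnit (_root_.relaxInput i φ) (inLit j true)) (by
      intro C hC
      rcases Finset.mem_insert.1 hC with rfl | hC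
      · exact hj
      · exact .base (Finset.mem_insert_of_mem (Finset.mem_insert_of_mem hC)))
  by_cases hki : k = i
  · subst hki
    rw [Finset.pair_comm] at himp
    refine hk.resolve (by simp [negLit, inLit, renameLit, hideVar]) ?_
    simpa [negLit, renameLit, inLit, hideVar] using himp
  · simpa [renameLit, inLit, hideVar, hki] using hk

/-- Relaxing an input variable of a p-encoding gives a propagation complete encoding of
`AMO`. -/
lemma IsPEncoding.isPCEncoding_relaxInput {φ : CNF (Var n ℓ)} (h : IsPEncoding φ) (i : Fin n) :
    IsPCEncoding (_root_.relaxInput i φ) (AMO n) := by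
  obtain ⟨β, hβ⟩ := h.exists_sat_unitAssign i
  exact (h.relaxInput i).isPCEncoding_AMO
    ⟨_, hβ.relaxInput (fun j hj => by simp [unitAssign, hj]) (by simp)⟩

lemma card_relaxInput_le (i : Fin n) (φ : CNF (Var n ℓ)) :
    (relaxInput i φ).card ≤ φ.card + 1 :=
  (Finset.card_insert_le _ _).trans (Nat.add_le_add_right Finset.card_image_le 1)

end PEncodings

/-- Let n ≥ 2, φ₁ a minimum size PC encoding of AMO_n and φ₂ a minimum
size PC encoding of EXO_n. Then S(n) ≤ |φ₁| ≤ S(n)+1 and S(n) ≤ |φ₂| ≤ S(n)+1. -/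
theorem min_pc_encoding_size_bounds (n : ℕ) (hn : 2 ≤ n)
    (ℓ₁ : ℕ) (φ₁ : CNF (Var n ℓ₁)) (h₁ : IsPCEncoding φ₁ (AMO n))
    (hmin₁ : ∀ ℓ' : ℕ, ∀ φ' : CNF (Var n ℓ'), IsPCEncoding φ' (AMO n) →
      φ₁.card ≤ φ'.card)
    (ℓ₂ : ℕ) (φ₂ : CNF (Var n ℓ₂)) (h₂ : IsPCEncoding φ₂ (EXO n))
    (hmin₂ : ∀ ℓ' : ℕ, ∀ φ' : CNF (Var n ℓ'), IsPCEncoding φ' (EXO n) →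
      φ₂.card ≤ φ'.card) :
    (S n ≤ φ₁.card ∧ φ₁.card ≤ S n + 1) ∧
    (S n ≤ φ₂.card ∧ φ₂.card ≤ S n + 1) := by
  have hp₁ : IsPEncoding φ₁ := h₁.isPEncoding (fun _ h => h) AMO_unitAssign
  have hp₂ : IsPEncoding φ₂ := h₂.isPEncoding (fun _ h => (EXO_iff.1 h).1) EXO_unitAssign
  have hmem₁ : φ₁.card ∈ pencSizes n := ⟨ℓ₁, φ₁, hp₁, rfl⟩
  obtain ⟨ℓ, φ, hφ, hcard⟩ : S n ∈ pencSizes n := Nat.sInf_mem ⟨_, hmem₁⟩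
  rw [← hcard]
  refine ⟨⟨hcard ▸ Nat.sInf_le hmem₁, ?_⟩, hcard ▸ Nat.sInf_le ⟨ℓ₂, φ₂, hp₂, rfl⟩, ?_⟩
  · exact (hmin₁ _ _ (hφ.isPCEncoding_relaxInput ⟨0, by omega⟩)).trans (card_relaxInput_le _ _)
  · exact (hmin₂ _ _ hφ.isPCEncoding_EXO).trans (Finset.card_insert_le _ _)
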